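/- Necessary condition for linear convergence of SPP: assume g ≡ 0, f satisfies the quadratic functional growth condition with constant μ > 0, each f(·,ξ) has L_f-Lipschitz continuous gradient, and the SPP iterates x_{t+1} = prox_{γ f(·,ξ_t)}(x_t) with constant stepsize γ > 0 satisfy, for some q < 1, the conditional contraction E_{ξ_t}[‖x_{t+1} − x̄_{t+1}‖² | ξ_{[t−1]}] ≤ q ‖x_t − x̄_t‖² for all t ≥ 0, and the iterates have almost surely the same projection onto the optimal set: x̄_t = x̄_0 for all t ≥ 0. Then E_ξ[‖∇f(x̄_0,ξ)‖²] = 0, i.e., the stochastic bounded gradient condition holds with B = 0 and all the partial functions f(·,ξ) have x̄_0 as a common minimizer. -/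

import Mathlib

open MeasureTheory

open Filter Topology in
/-- If approximate minimizers along a countable family are forced to be close to `y`, then `y`
inherits a.e.-measurability from the values of the objective along that family. -/
lemma aemeasurable_of_dist_sq_le_sub_iInf {Ω E : Type*} [MeasurableSpace Ω] {P : Measure Ω}
    [PseudoMetricSpace E] [MeasurableSpace E] [BorelSpace E]
    {d : ℕ → E} {φ : ℕ → Ω → ℝ} (hφ : ∀ k, AEMeasurable (φ k) P) {y : Ω → E} {v : Ω → ℝ} {c : ℝ}
    (hc : 0 < c) (hle : ∀ k ω, c * dist (d k) (y ω) ^ 2 ≤ φ k ω - v ω)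
    (hlt : ∀ ω, ∀ ε > 0, ∃ k, φ k ω < v ω + ε) : AEMeasurable y P := by
  have hv : ∀ ω, ⨅ k, φ k ω = v ω := fun ω => by
    refine ciInf_eq_of_forall_ge_of_forall_gt_exists_lt (fun k => ?_) fun w hw => ?_
    · have : 0 ≤ c * dist (d k) (y ω) ^ 2 := by positivity
      linarith [hle k ω]
    · obtain ⟨k, hk⟩ := hlt ω (w - v ω) (sub_pos.2 hw)
      exact ⟨k, by linarith⟩
  let H : ℕ → Ω → ℝ := fun k => (hφ k).mk
  have hH : ∀ k, Measurable (H k) := fun k => (hφ k).measurable_mk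
  have hHae : ∀ᵐ ω ∂P, ∀ k, φ k ω = H k ω := ae_all_iff.2 fun k => (hφ k).ae_eq_mk
  have hex : ∀ (n : ℕ) ω, ∃ k, H k ω < (⨅ k, H k ω) + 1 / ((n : ℝ) + 1) := fun n ω =>
    exists_lt_of_ciInf_lt (lt_add_of_pos_right _ (by positivity))
  classical
  let Y : ℕ → Ω → E := fun n ω => d (Nat.find (hex n ω))
  have hY : ∀ n, Measurable (Y n) := fun n =>
    Measurable.find (f := fun k _ => d k) (fun _ => measurable_const)
      (fun k => measurableSet_lt (hH k) ((Measurable.iInf hH).add_const _)) (hex n)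
  refine aemeasurable_of_tendsto_metrizable_ae' (fun n => (hY n).aemeasurable) ?_
  filter_upwards [hHae] with ω hω
  have key : ∀ n, dist (Y n ω) (y ω) ^ 2 ≤ c⁻¹ * (1 / ((n : ℝ) + 1)) := fun n => by
    have h1 := Nat.find_spec (hex n ω)
    have h2 := hle (Nat.find (hex n ω)) ω
    have h3 : ⨅ k, H k ω = v ω := by rw [← hv]; exact (iInf_congr hω).symm
    rw [le_inv_mul_iff₀ hc]
    refine h2.trans ?_
    rw [hω]
    linarith
  rw [tendsto_iff_dist_tendsto_zero]
  have hsq : Tendsto (fun n => dist (Y n ω) (y ω) ^ 2) atTop (𝓝 0) := by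
    refine squeeze_zero (fun _ => sq_nonneg _) key ?_
    simpa using tendsto_one_div_add_atTop_nhds_zero_nat.const_mul c⁻¹
  simpa [Real.sqrt_sq dist_nonneg] using hsq.sqrt

/-- First-order lower bound for a differentiable convex function. -/
lemma ConvexOn.add_inner_gradient_le {E : Type*} [NormedAddCommGroup E] [InnerProductSpace ℝ E]
    [CompleteSpace E] {h : E → ℝ} (hc : ConvexOn ℝ Set.univ h) {g a : E}
    (hg : HasGradientAt h g a) (b : E) : h a + inner ℝ g (b - a) ≤ h b := by
  have hline : ConvexOn ℝ Set.univ (h ∘ AffineMap.lineMap (k := ℝ) a b) :=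
    hc.comp_affineMap (AffineMap.lineMap a b)
  have hd : HasDerivAt (h ∘ AffineMap.lineMap (k := ℝ) a b) (inner ℝ g (b - a)) 0 := by
    have h1 : HasFDerivAt h (InnerProductSpace.toDual ℝ E g) (AffineMap.lineMap (k := ℝ) a b 0) := by
      simpa using hg.hasFDerivAt
    simpa using h1.comp_hasDerivAt (0 : ℝ) AffineMap.hasDerivAt_lineMap
  have := hline.le_slope_of_hasDerivAt (Set.mem_univ 0) (Set.mem_univ 1) one_pos hd
  simp [slope_def_field] at this
  linarith

/-- The optimality condition of the proximal step for a differentiable function. -/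
lemma HasGradientAt.eq_of_isMinOn_prox {E : Type*} [NormedAddCommGroup E] [InnerProductSpace ℝ E]
    [CompleteSpace E] {h : E → ℝ} {g y z : E} {γ : ℝ} (hγ : 0 < γ) (hg : HasGradientAt h g y)
    (hmin : IsMinOn (fun w => h w + 1 / (2 * γ) * ‖w - z‖ ^ 2) Set.univ y) :
    z - y = γ • g := by
  have hd := hg.hasFDerivAt.add
    ((((hasFDerivAt_id y).sub_const z).norm_sq).const_mul (1 / (2 * γ)))
  have h0 := IsLocalMin.hasFDerivAt_eq_zero (hmin.isLocalMin Filter.univ_mem) hd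
  have hin : ∀ v, inner ℝ (γ • g - (z - y)) v = 0 := fun v => by
    have := congrArg (fun T => T v) h0
    simp at this
    simp only [inner_sub_left, inner_smul_left] at this ⊢
    simp
    field_simp at this
    linarith
  exact (sub_eq_zero.1 (inner_self_eq_zero.1 (hin _))).symm

/-- Quadratic growth of the proximal objective around its minimizer. -/
lemma ConvexOn.prox_quadratic_growth {E : Type*} [NormedAddCommGroup E] [InnerProductSpace ℝ E]
    [CompleteSpace E] {h : E → ℝ} (hc : ConvexOn ℝ Set.univ h) {g y z : E} {γ : ℝ} (hγ : 0 < γ)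
    (hg : HasGradientAt h g y) (hyz : z - y = γ • g) (w : E) :
    1 / (2 * γ) * dist w y ^ 2 ≤
      (h w + 1 / (2 * γ) * ‖w - z‖ ^ 2) - (h y + 1 / (2 * γ) * ‖y - z‖ ^ 2) := by
  have h1 := hc.add_inner_gradient_le hg w
  have h2 : w - z = (w - y) - γ • g := by rw [← hyz]; abel
  have h3 : y - z = -(γ • g) := by rw [← hyz]; abel
  rw [h2, h3, norm_neg, norm_sub_sq_real, dist_eq_norm, inner_smul_right, real_inner_comm]
  have : 1 / (2 * γ) * (‖w - y‖ ^ 2 - 2 * (γ * inner ℝ g (w - y)) + ‖γ • g‖ ^ 2)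
    = 1 / (2 * γ) * ‖w - y‖ ^ 2 - inner ℝ g (w - y) + 1 / (2 * γ) * ‖γ • g‖ ^ 2 := by
    field_simp
  linarith

/-- The proximal step moves away from a reference point `p` at most as much as its gradient
allows. -/
lemma ConvexOn.norm_prox_sub_le {E : Type*} [NormedAddCommGroup E] [InnerProductSpace ℝ E]
    [CompleteSpace E] {h : E → ℝ} (hc : ConvexOn ℝ Set.univ h) {g y z p gp : E} {γ : ℝ}
    (hγ : 0 < γ) (hg : HasGradientAt h g y) (hgp : HasGradientAt h gp p) (hyz : z - y = γ • g) :
    ‖y - p‖ ≤ ‖z - p‖ + γ * ‖gp‖ := by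
  have h1 := hc.add_inner_gradient_le hg p
  have h2 := hc.add_inner_gradient_le hgp y
  have h3 : inner ℝ gp (y - p) ≤ inner ℝ g (y - p) := by
    rw [← neg_sub y p, inner_neg_right] at h1
    linarith
  have h4 : inner ℝ (y - p) (y - p) = inner ℝ (z - p) (y - p) - γ * inner ℝ g (y - p) := by
    have : y - p = (z - p) - γ • g := by rw [← hyz]; abel
    nth_rewrite 1 [this]
    rw [inner_sub_left, inner_smul_left]; simp
  have h5 := real_inner_le_norm (z - p) (y - p)
  have h6 := abs_le.1 (abs_real_inner_le_norm gp (y - p))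
  rw [real_inner_self_eq_norm_sq] at h4
  have h7 : ‖y - p‖ * ‖y - p‖ ≤ (‖z - p‖ + γ * ‖gp‖) * ‖y - p‖ := by nlinarith
  rcases (norm_nonneg (y - p)).eq_or_lt with h | h
  · rw [← h]; positivity
  · exact le_of_mul_le_mul_right h7 h

open Filter Topology in
/-- The gradient of a random convex function is integrable at `z` as soon as the function is
integrable near `z`. -/
lemma integrable_gradient_of_eventually {ι Ω : Type*} [Fintype ι] [MeasurableSpace Ω]
    {P : Measure Ω} {f : EuclideanSpace ℝ ι → Ω → ℝ}
    (hconv : ∀ ω, ConvexOn ℝ Set.univ (fun y => f y ω)) {z : EuclideanSpace ℝ ι}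
    {g : Ω → EuclideanSpace ℝ ι} (hgrad : ∀ ω, HasGradientAt (fun y => f y ω) (g ω) z)
    (hz : ∀ᶠ y in 𝓝 z, Integrable (f y) P) : Integrable g P := by
  classical
  refine Integrable.of_eval_piLp fun i => ?_
  let e : EuclideanSpace ℝ ι := EuclideanSpace.single i 1
  have hcoord : ∀ ω, g ω i = inner ℝ (g ω) e := fun ω => by
    simp [e, EuclideanSpace.inner_single_right]
  simp only [hcoord]
  have hline : ∀ v : EuclideanSpace ℝ ι, ∀ᶠ t in 𝓝 (0 : ℝ),
      Integrable (f (z + t • v)) P := fun v => by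
    have : Tendsto (fun t : ℝ => z + t • v) (𝓝 0) (𝓝 z) := by
      have h : Continuous fun t : ℝ => z + t • v := by fun_prop
      simpa using h.tendsto 0
    exact this.eventually hz
  have hz0 : Integrable (f z) P := hz.self_of_nhds
  have hmeas : AEStronglyMeasurable (fun ω => inner ℝ (g ω) e) P := by
    have ht : Tendsto (fun n : ℕ => 1 / ((n : ℝ) + 1)) atTop (𝓝 0) :=
      tendsto_one_div_add_atTop_nhds_zero_nat
    obtain ⟨N, hN⟩ := eventually_atTop.1 (ht.eventually (hline e))
    let t : ℕ → ℝ := fun n => 1 / (((n + N : ℕ) : ℝ) + 1)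
    refine aestronglyMeasurable_of_tendsto_ae (u := atTop)
      (f := fun n ω => (t n)⁻¹ • (f (z + t n • e) ω - f z ω))
      (fun n => ((hN _ (Nat.le_add_left N n)).sub hz0).aestronglyMeasurable.const_smul
        (t n)⁻¹)
      (ae_of_all _ fun ω => ?_)
    have hd : HasDerivAt (fun s : ℝ => f (z + s • e) ω) (inner ℝ (g ω) e) 0 := by
      have h1 : HasFDerivAt (fun y => f y ω) (InnerProductSpace.toDual ℝ _ (g ω))
          (z + (0 : ℝ) • e) := by
        simpa using (hgrad ω).hasFDerivAt
      have h2 : HasDerivAt (fun s : ℝ => z + s • e) e 0 := by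
        simpa using ((hasDerivAt_id (0 : ℝ)).smul_const e).const_add z
      exact h1.comp_hasDerivAt (0 : ℝ) h2
    have ht' : Tendsto t atTop (𝓝[≠] 0) :=
      tendsto_nhdsWithin_iff.2 ⟨ht.comp (tendsto_add_atTop_nat N),
        Eventually.of_forall fun n => (by positivity : t n ≠ 0)⟩
    simpa [Function.comp_def] using hd.tendsto_slope_zero.comp ht'
  obtain ⟨δ, hδ, h1, h2⟩ :
      ∃ δ : ℝ, 0 < δ ∧ Integrable (f (z + δ • e)) P ∧ Integrable (f (z + δ • -e)) P := by
    have := ((hline e).and (hline (-e))).filter_mono (nhdsWithin_le_nhds (s := Set.Ioi 0))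
    obtain ⟨δ, h, hδ⟩ := (this.and self_mem_nhdsWithin).exists
    exact ⟨δ, hδ, h.1, h.2⟩
  refine integrable_of_le_of_le hmeas (ae_of_all _ fun ω => ?_) (ae_of_all _ fun ω => ?_)
    ((hz0.sub h2).const_mul δ⁻¹) ((h1.sub hz0).const_mul δ⁻¹)
  · have := (hconv ω).add_inner_gradient_le (hgrad ω) (z + δ • -e)
    simp only [add_sub_cancel_left, inner_smul_right, inner_neg_right] at this
    rw [inv_mul_le_iff₀ hδ]
    simp only [Pi.sub_apply]
    linarith
  · have := (hconv ω).add_inner_gradient_le (hgrad ω) (z + δ • e)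
    simp only [add_sub_cancel_left, inner_smul_right] at this
    rw [le_inv_mul_iff₀ hδ]
    simp only [Pi.sub_apply]
    linarith

open Filter Topology in
/-- For random convex functions with uniformly Lipschitz gradients, integrability of values and
gradients on an open set extends to its closure. -/
lemma integrable_of_mem_closure {ι Ω : Type*} [Fintype ι] [MeasurableSpace Ω]
    {P : Measure Ω} [IsFiniteMeasure P] {f : EuclideanSpace ℝ ι → Ω → ℝ}
    (hconv : ∀ ω, ConvexOn ℝ Set.univ (fun y => f y ω))
    {df : EuclideanSpace ℝ ι → Ω → EuclideanSpace ℝ ι}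
    (hgrad : ∀ z ω, HasGradientAt (fun y => f y ω) (df z ω) z) {L : ℝ}
    (hLip : ∀ ω z y, ‖df z ω - df y ω‖ ≤ L * ‖z - y‖)
    {U : Set (EuclideanSpace ℝ ι)} (hU : IsOpen U) (hint : ∀ y ∈ U, Integrable (f y) P)
    {a : EuclideanSpace ℝ ι} (ha : a ∈ closure U) :
    Integrable (f a) P ∧ Integrable (df a) P := by
  have hdint : ∀ y ∈ U, Integrable (df y) P := fun y hy =>
    integrable_gradient_of_eventually hconv (hgrad y)
      ((hU.mem_nhds hy |> eventually_mem_set.2).mono hint)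
  obtain ⟨u, huU, hu⟩ := mem_closure_iff_seq_limit.1 ha
  have hfm : AEStronglyMeasurable (f a) P :=
    aestronglyMeasurable_of_tendsto_ae atTop (f := fun n => f (u n))
      (fun n => (hint _ (huU n)).aestronglyMeasurable)
      (ae_of_all _ fun ω => ((hgrad a ω).continuousAt.tendsto.comp hu))
  have hdm : AEStronglyMeasurable (df a) P := by
    refine aestronglyMeasurable_of_tendsto_ae atTop (f := fun n => df (u n))
      (fun n => (hdint _ (huU n)).aestronglyMeasurable) (ae_of_all _ fun ω => ?_)
    rw [tendsto_iff_norm_sub_tendsto_zero] at hu ⊢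
    exact squeeze_zero (fun _ => norm_nonneg _) (fun n => hLip ω _ _)
      (by simpa using hu.const_mul L)
  have hd0 := hdint _ (huU 0)
  have hf0 := hint _ (huU 0)
  have hda : Integrable (df a) P := by
    refine (hd0.norm.add (integrable_const (L * ‖a - u 0‖))).mono' hdm (ae_of_all _ fun ω => ?_)
    have h1 := hLip ω a (u 0)
    have h2 := norm_sub_norm_le (df a ω) (df (u 0) ω)
    simp only [Pi.add_apply]
    linarith
  refine ⟨integrable_of_le_of_le hfm (ae_of_all _ fun ω => ?_) (ae_of_all _ fun ω => ?_)
    (hf0.add (hd0.inner_const (a - u 0))) (hf0.sub (hda.inner_const (u 0 - a))), hda⟩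
  · exact (hconv ω).add_inner_gradient_le (hgrad _ ω) a
  · have := (hconv ω).add_inner_gradient_le (hgrad a ω) (u 0)
    simp only [Pi.sub_apply]
    linarith

/-- Proximal points of a random convex function are a.e.-measurable if they lie in a set on which
the function is. -/
lemma aemeasurable_prox {E Ω : Type*} [NormedAddCommGroup E] [InnerProductSpace ℝ E]
    [CompleteSpace E] [SecondCountableTopology E] [MeasurableSpace E] [BorelSpace E]
    [MeasurableSpace Ω] {P : Measure Ω} {f : E → Ω → ℝ}
    (hconv : ∀ ω, ConvexOn ℝ Set.univ (fun y => f y ω)) {df : E → Ω → E}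
    (hgrad : ∀ z ω, HasGradientAt (fun y => f y ω) (df z ω) z) {γ : ℝ} (hγ : 0 < γ) {z : E}
    {y : Ω → E} (hy : ∀ ω, z - y ω = γ • df (y ω) ω) {C : Set E} (hC : C.Nonempty)
    (hmeas : ∀ c ∈ C, AEMeasurable (f c) P) (hyC : ∀ ω, y ω ∈ C) : AEMeasurable y P := by
  have := hC.to_subtype
  let d : ℕ → E := fun k => (TopologicalSpace.denseSeq C k : E)
  refine aemeasurable_of_dist_sq_le_sub_iInf (d := d)
    (φ := fun k ω => f (d k) ω + 1 / (2 * γ) * ‖d k - z‖ ^ 2)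
    (v := fun ω => f (y ω) ω + 1 / (2 * γ) * ‖y ω - z‖ ^ 2) (c := 1 / (2 * γ))
    (fun k => (hmeas _ (TopologicalSpace.denseSeq C k).2).add_const _) (by positivity)
    (fun k ω => (hconv ω).prox_quadratic_growth hγ (hgrad _ ω) (hy ω) (d k)) fun ω ε hε => ?_
  have hf : Continuous fun w => f w ω :=
    continuous_iff_continuousAt.2 fun w => (hgrad w ω).continuousAt
  have hcont : Continuous fun w : C => f w ω + 1 / (2 * γ) * ‖(w : E) - z‖ ^ 2 := by fun_prop
  exact (TopologicalSpace.denseRange_denseSeq C).exists_mem_open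
    (isOpen_Iio.preimage hcont) ⟨⟨y ω, hyC ω⟩, by simpa using hε⟩

/-- If the expected value is nonzero at a minimizer, then it is nonzero on a dense set; the
expectation is taken with the convention that it vanishes for non-integrable functions. -/
lemma closure_integral_ne_zero_eq_univ {ι Ω : Type*} [Fintype ι] [MeasurableSpace Ω]
    {P : Measure Ω} [IsFiniteMeasure P] {f : EuclideanSpace ℝ ι → Ω → ℝ}
    (hconv : ∀ ω, ConvexOn ℝ Set.univ (fun y => f y ω))
    {df : EuclideanSpace ℝ ι → Ω → EuclideanSpace ℝ ι}
    (hgrad : ∀ z ω, HasGradientAt (fun y => f y ω) (df z ω) z) {L : ℝ}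
    (hLip : ∀ ω z y, ‖df z ω - df y ω‖ ≤ L * ‖z - y‖)
    (hunb : ∀ z, HasGradientAt (fun y => ∫ ω, f y ω ∂P) (∫ ω, df z ω ∂P) z)
    {p : EuclideanSpace ℝ ι} (hp : ∀ y, ∫ ω, f p ω ∂P ≤ ∫ ω, f y ω ∂P)
    (hp0 : ∫ ω, f p ω ∂P ≠ 0) : closure {y | ∫ ω, f y ω ∂P ≠ 0} = Set.univ := by
  set U := {y | ∫ ω, f y ω ∂P ≠ 0}
  have hcont : Continuous fun y => ∫ ω, f y ω ∂P :=
    continuous_iff_continuousAt.2 fun z => (hunb z).continuousAt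
  have hU : IsOpen U := isOpen_ne.preimage hcont
  have hint : ∀ y ∈ U, Integrable (f y) P := fun y hy => by
    by_contra h
    exact hy (integral_undef h)
  refine Set.eq_univ_of_forall fun w => by_contra fun hw => ?_
  obtain ⟨a, haU, had⟩ := isClosed_closure.exists_infDist_eq_dist 
    ⟨p, subset_closure (s := U) hp0⟩ w
  have hpos : 0 < dist w a := dist_pos.2 fun h => hw (h ▸ haU)
  have hball : ∀ y ∈ Metric.ball w (dist w a), ∫ ω, f y ω ∂P = 0 := fun y hy => by
    by_contra h
    have := Metric.infDist_le_dist_of_mem (x := w) (subset_closure h : y ∈ closure U)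
    rw [Metric.mem_ball, dist_comm] at hy
    linarith
  have hcball : ∀ y ∈ Metric.closedBall w (dist w a), ∫ ω, f y ω ∂P = 0 := fun y hy => by
    rw [← closure_ball w hpos.ne'] at hy
    exact (isClosed_singleton.preimage hcont).closure_subset_iff.2 hball hy
  have ha : a ∈ Metric.closedBall w (dist w a) := by simp [dist_comm]
  have huniq := uniqueDiffWithinAt_convex (convex_closedBall w (dist w a))
    (by rw [interior_closedBall w hpos.ne']; exact ⟨w, Metric.mem_ball_self hpos⟩)
    (subset_closure ha)
  have hzero := huniq.eq (hunb a).hasFDerivAt.hasFDerivWithinAt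
    ((hasFDerivWithinAt_const (0 : ℝ) a _).congr hcball (hcball a ha))
  have hG : ∫ ω, df a ω ∂P = 0 := by simpa using hzero
  obtain ⟨hfa, hda⟩ := integrable_of_mem_closure hconv hgrad hLip hU hint haU
  have hmono : ∫ ω, (f a ω + inner ℝ (df a ω) (p - a)) ∂P ≤ ∫ ω, f p ω ∂P :=
    integral_mono (hfa.add (hda.inner_const _)) (hint p hp0)
      fun ω => (hconv ω).add_inner_gradient_le (hgrad a ω) p
  have hinner : ∫ ω, inner ℝ (df a ω) (p - a) ∂P = 0 := by
    simp_rw [real_inner_comm (p - a)]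
    rw [integral_inner hda, hG, inner_zero_right]
  rw [integral_add hfa (hda.inner_const _), hinner, hcball a ha, add_zero] at hmono
  exact hp0 (le_antisymm ((hp a).trans_eq (hcball a ha)) hmono)

/-- A point whose projection onto a set is interior to that set belongs to the set. -/
lemma eq_of_norm_sub_le_of_mem_interior {E : Type*} [NormedAddCommGroup E] [NormedSpace ℝ E]
    {s : Set E} {z p : E} (hp : p ∈ interior s) (hle : ∀ w ∈ s, ‖z - p‖ ≤ ‖z - w‖) : z = p := by
  by_contra hne
  have hcont : Continuous fun t : ℝ => p + t • (z - p) := by fun_prop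
  have h0 : ∀ᶠ t in nhds (0 : ℝ), p + t • (z - p) ∈ s := by
    refine (hcont.tendsto 0).eventually_mem (s := s) ?_
    simpa using mem_interior_iff_mem_nhds.1 hp
  obtain ⟨t, hts, ht0, ht1⟩ := ((h0.filter_mono nhdsWithin_le_nhds).and
    (Ioo_mem_nhdsGT (zero_lt_one' ℝ))).exists
  have h1 := hle _ hts
  have h2 : z - (p + t • (z - p)) = (1 - t) • (z - p) := by module
  rw [h2, norm_smul, Real.norm_of_nonneg (by linarith)] at h1
  have h3 : 0 < ‖z - p‖ := norm_pos_iff.2 (sub_ne_zero.2 hne)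
  nlinarith

/-- Theorem 2.6 for SPP (necessary condition for linear convergence): with `g ≡ 0`, if
`fbar(x) = E_ξ[f(x,ξ)]` satisfies quadratic functional growth with `μ > 0`, each `f(·,ξ)`
is convex with `Lf`-Lipschitz gradient, the SPP iterates
`x (t+1) = prox_{γ f(·,ξ t)}(x t)` (constant stepsize `γ > 0`, `x 0` deterministic)
contract conditionally on the past at rate `q < 1`, and all iterates have the same
projection `x̄ 0` onto the optimal set, then `E_ξ[‖∇f(x̄ 0, ξ)‖²] = 0`, i.e. the
strong stochastic bounded gradient condition (`B = 0`) holds and all partial functions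
`f(·,ξ)` have `x̄ 0` as a common minimizer. -/
theorem stmt_10 {m : ℕ} {Ω : Type*} [MeasurableSpace Ω]
    (P : Measure Ω) [IsProbabilityMeasure P]
    (f : EuclideanSpace ℝ (Fin m) → Ω → ℝ)
    (hfconv : ∀ ω, ConvexOn ℝ Set.univ (fun y => f y ω))
    (df : EuclideanSpace ℝ (Fin m) → Ω → EuclideanSpace ℝ (Fin m))
    (hgrad : ∀ z ω, HasGradientAt (fun y => f y ω) (df z ω) z)
    (Lf : ℝ) (hLf : 0 < Lf)
    (hLip : ∀ ω z y, ‖df z ω - df y ω‖ ≤ Lf * ‖z - y‖)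
    (fbar : EuclideanSpace ℝ (Fin m) → ℝ)
    (hfbar : ∀ y, fbar y = ∫ ω, f y ω ∂P)
    -- unbiasedness: `E_ξ[∇f(x,ξ)] = ∇fbar(x)`
    (hunb : ∀ z, HasGradientAt fbar (∫ ω, df z ω ∂P) z)
    (Xstar : Set (EuclideanSpace ℝ (Fin m))) (hXne : Xstar.Nonempty)
    (hXstar : Xstar = {z | ∀ y, fbar z ≤ fbar y})
    (proj : EuclideanSpace ℝ (Fin m) → EuclideanSpace ℝ (Fin m))
    (hprojmem : ∀ x, proj x ∈ Xstar)
    (hprojdist : ∀ x, ∀ z ∈ Xstar, ‖x - proj x‖ ≤ ‖x - z‖)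
    -- quadratic functional growth (Assumption 2) with `μ > 0`
    (μ : ℝ) (hμ : 0 < μ)
    (hgrowth : ∀ z, μ / 2 * ‖z - proj z‖ ^ 2 ≤ fbar z - fbar (proj z))
    -- SPP iterates with constant stepsize, viewed pathwise over realizations `ω : ℕ → Ω`
    (γ : ℝ) (hγ : 0 < γ)
    (prx : EuclideanSpace ℝ (Fin m) → Ω → EuclideanSpace ℝ (Fin m))
    (hprx : ∀ z ξ, IsMinOn (fun y => f y ξ + 1 / (2 * γ) * ‖y - z‖ ^ 2)
      Set.univ (prx z ξ))
    (x : ℕ → (ℕ → Ω) → EuclideanSpace ℝ (Fin m))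
    (x0 : EuclideanSpace ℝ (Fin m)) (hx0 : ∀ ω, x 0 ω = x0)
    (hiter : ∀ t ω, x (t + 1) ω = prx (x t ω) (ω t))
    -- conditional linear contraction: `E_{ξ t}[‖x (t+1) - x̄ (t+1)‖² | ξ_{[t-1]}] ≤ q ‖x t - x̄ t‖²`
    (q : ℝ) (hq : q < 1)
    (hcontr : ∀ t (ω : ℕ → Ω),
      ∫ ξ, ‖prx (x t ω) ξ - proj (prx (x t ω) ξ)‖ ^ 2 ∂P
        ≤ q * ‖x t ω - proj (x t ω)‖ ^ 2)
    -- the iterates have a.s. the same projection onto the optimal set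
    (hsameproj : ∀ t (ω : ℕ → Ω), proj (x t ω) = proj x0) :
    ∫ ω, ‖df (proj x0) ω‖ ^ 2 ∂P = 0 := by
  set p := proj x0
  have hopt : ∀ ξ z, z - prx z ξ = γ • df (prx z ξ) ξ := fun ξ z =>
    (hgrad _ ξ).eq_of_isMinOn_prox hγ (hprx z ξ)
  have hcausal : ∀ t (ω ω' : ℕ → Ω), (∀ s < t, ω s = ω' s) → x t ω = x t ω' := by
    intro t
    induction t with
    | zero => intro ω ω' _; rw [hx0, hx0]
    | succ t ih =>
      intro ω ω' h
      rw [hiter, hiter, ih ω ω' fun s hs => h s (hs.trans t.lt_succ_self), h t t.lt_succ_self]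
  have hreach : ∀ t (ω : ℕ → Ω) ξ, ∃ ω', x (t + 1) ω' = prx (x t ω) ξ := fun t ω ξ => by
    refine ⟨Function.update ω t ξ, ?_⟩
    rw [hiter, Function.update_self,
      hcausal t (Function.update ω t ξ) ω fun s hs => Function.update_of_ne hs.ne _ _]
  have hprojprx : ∀ t (ω : ℕ → Ω) ξ, proj (prx (x t ω) ξ) = p := fun t ω ξ => by
    obtain ⟨ω', h⟩ := hreach t ω ξ
    rw [← h, hsameproj]
  have hpX : p ∈ Xstar := hprojmem x0
  have hpmin : ∀ y, fbar p ≤ fbar y := by rw [hXstar] at hpX; exact hpX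
  by_cases hpint : p ∈ interior Xstar
  · have hfix : ∀ z, proj z = p → z = p := fun z hz =>
      eq_of_norm_sub_le_of_mem_interior hpint (hz ▸ hprojdist z)
    have hzero : ∀ ξ, df p ξ = 0 := fun ξ => by
      have h1 : x0 = p := hfix x0 rfl
      have h2 := hfix _ (hprojprx 0 (fun _ => ξ) ξ)
      rw [hx0, h1] at h2
      have h3 := hopt ξ p
      rw [h2, sub_self] at h3
      exact (smul_eq_zero.1 h3.symm).resolve_left hγ.ne'
    simp [hzero]
  by_cases hsq : Integrable (fun ω => ‖df p ω‖ ^ 2) P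
  swap
  · exact integral_undef hsq
  obtain rfl : fbar = fun y => ∫ ω, f y ω ∂P := funext hfbar
  set U := {y | ∫ ω, f y ω ∂P ≠ 0}
  have hcont : Continuous fun y => ∫ ω, f y ω ∂P :=
    continuous_iff_continuousAt.2 fun z => (hunb z).continuousAt
  have hU : IsOpen U := isOpen_ne.preimage hcont
  have hint : ∀ y ∈ U, Integrable (f y) P := fun y hy => by
    by_contra h
    exact hy (integral_undef h)
  have hclos : ∀ y, proj y = p → y ∈ closure U := fun y hy => by
    by_cases hp0 : ∫ ω, f p ω ∂P = 0
    · have hsub : Xstarᶜ ⊆ U := fun w hw h => by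
        refine hw ?_
        rw [hXstar]
        intro v
        have := hpmin v
        simp only [hp0] at this
        simpa only [h] using this
      by_cases hyX : y ∈ Xstar
      · have h1 := hprojdist y y hyX
        rw [hy, sub_self, norm_zero, norm_le_zero_iff, sub_eq_zero] at h1
        rw [h1]
        refine closure_mono hsub ?_
        rwa [closure_compl]
      · exact subset_closure (hsub hyX)
    · rw [closure_integral_ne_zero_eq_univ hfconv hgrad hLip hunb hpmin hp0]
      trivial
  have hprxm : ∀ t ω, AEMeasurable (prx (x t ω)) P := fun t ω =>
    aemeasurable_prox hfconv hgrad hγ (fun ξ => hopt ξ _) ⟨x0, hclos x0 rfl⟩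
      (fun c hc => (integrable_of_mem_closure hfconv hgrad hLip hU hint hc).1.aemeasurable)
      fun ξ => hclos _ (hprojprx t ω ξ)
  have hprxint : ∀ t ω, Integrable (fun ξ => ‖prx (x t ω) ξ - p‖ ^ 2) P := fun t ω => by
    refine (((integrable_const (‖x t ω - p‖ ^ 2)).add (hsq.const_mul (γ ^ 2))).const_mul 2).mono'
      (((hprxm t ω).sub_const p).norm.pow_const 2).aestronglyMeasurable (ae_of_all _ fun ξ => ?_)
    have h1 := (hfconv ξ).norm_prox_sub_le hγ (hgrad _ ξ) (hgrad p ξ) (hopt ξ (x t ω))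
    have h2 := pow_le_pow_left₀ (norm_nonneg _) h1 2
    rw [Real.norm_of_nonneg (sq_nonneg _)]
    simp only [Pi.add_apply]
    nlinarith [sq_nonneg (‖x t ω - p‖ - γ * ‖df p ξ‖)]
  have hcontr' : ∀ t ω, ∫ ξ, ‖prx (x t ω) ξ - p‖ ^ 2 ∂P ≤ max q 0 * ‖x t ω - p‖ ^ 2 :=
    fun t ω => by
      have h1 := hcontr t ω
      simp only [hprojprx, hsameproj] at h1
      exact h1.trans (by gcongr; exact le_max_left _ _)
  have hpath : ∀ t, ∃ ω, ‖x t ω - p‖ ^ 2 ≤ max q 0 ^ t * ‖x0 - p‖ ^ 2 := by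
    intro t
    induction t with
    | zero =>
      obtain ⟨ξ⟩ := nonempty_of_isProbabilityMeasure P
      exact ⟨fun _ => ξ, by simp [hx0]⟩
    | succ t ih =>
      obtain ⟨ω, hω⟩ := ih
      obtain ⟨ξ, hξ⟩ := exists_le_integral (hprxint t ω)
      obtain ⟨ω', hω'⟩ := hreach t ω ξ
      refine ⟨ω', ?_⟩
      rw [hω', pow_succ' (max q 0), mul_assoc]
      exact hξ.trans ((hcontr' t ω).trans (by gcongr))
  let A := 2 * γ⁻¹ ^ 2 + 2 * (γ⁻¹ + Lf) ^ 2 * max q 0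
  have hbound : ∀ t ω, ∫ ξ, ‖df p ξ‖ ^ 2 ∂P ≤ A * ‖x t ω - p‖ ^ 2 := fun t ω => by
    have hpt : ∀ ξ, ‖df p ξ‖ ^ 2 ≤
        2 * γ⁻¹ ^ 2 * ‖x t ω - p‖ ^ 2 + 2 * (γ⁻¹ + Lf) ^ 2 * ‖prx (x t ω) ξ - p‖ ^ 2 := fun ξ => by
      set z := x t ω
      set y := prx z ξ
      have h1 : df y ξ = γ⁻¹ • (z - y) := by rw [hopt ξ z, inv_smul_smul₀ hγ.ne']
      have h2 : ‖df y ξ‖ ≤ γ⁻¹ * (‖z - p‖ + ‖y - p‖) := by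
        rw [h1, norm_smul, Real.norm_of_nonneg (by positivity), norm_sub_rev y p]
        gcongr
        exact norm_sub_le_norm_sub_add_norm_sub z p y
      have h3 := norm_sub_norm_le (df p ξ) (df y ξ)
      have h4 := hLip ξ p y
      rw [norm_sub_rev p y] at h4
      have h5 : ‖df p ξ‖ ≤ γ⁻¹ * ‖z - p‖ + (γ⁻¹ + Lf) * ‖y - p‖ := by linarith
      have h6 := pow_le_pow_left₀ (norm_nonneg _) h5 2
      nlinarith [sq_nonneg (γ⁻¹ * ‖z - p‖ - (γ⁻¹ + Lf) * ‖y - p‖)]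
    have hi := (hprxint t ω).const_mul (2 * (γ⁻¹ + Lf) ^ 2)
    refine (integral_mono hsq ((integrable_const _).add hi) hpt).trans ?_
    simp only [Pi.add_apply]
    rw [integral_add (integrable_const _) hi,
      integral_const_mul _ fun ξ => ‖prx (x t ω) ξ - p‖ ^ 2]
    have h7 := mul_le_mul_of_nonneg_left (hcontr' t ω)
      (by positivity : 0 ≤ 2 * (γ⁻¹ + Lf) ^ 2)
    simp only [integral_const, probReal_univ, one_smul, A]
    linarith
  have hlim : Filter.Tendsto (fun t : ℕ => A * (max q 0 ^ t * ‖x0 - p‖ ^ 2)) Filter.atTop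
      (nhds 0) := by
    simpa using ((tendsto_pow_atTop_nhds_zero_of_lt_one (le_max_right q 0)
      (max_lt hq one_pos)).mul_const (‖x0 - p‖ ^ 2)).const_mul A
  refine le_antisymm (ge_of_tendsto' hlim fun t => ?_) (integral_nonneg fun ξ => sq_nonneg _)
  obtain ⟨ω, hω⟩ := hpath t
  exact (hbound t ω).trans (mul_le_mul_of_nonneg_left hω (by positivity))
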